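/- Let F_0 be a class of functions from A × X to [−1,1] containing f*, let (a_1,x_1),…,(a_T,x_T) ∈ A × X, let ẑ_1,…,ẑ_T ∈ ℝ, let R ≥ 1, and for each t ∈ [T] let F_t := {f ∈ F_0 : Σ_{s=1}^{t−1} (f(a_s,x_s) − ẑ_s)² ≤ R}. Assume that for every t ∈ [T] we have f* ∈ F_t and inf_{f ∈ F_t} f(a_t, x_t) ≤ 0 (each played action lies in the optimistic set). Then the total constraint violation satisfies, for every α > 0, Σ_{t=1}^T f*(a_t, x_t) ≤ α T + (20 R / α) · E(F_0, α). -/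

import Mathlib

/-- `q` is ε-dependent, w.r.t. the class `F`, on the subsequence of `p` indexed by the
finite index set `I`. -/
def epsDep {S : Type*} (F : Set (S → ℝ)) (ε : ℝ) (p : ℕ → S) (I : Finset ℕ) (q : S) : Prop :=
  ∀ f ∈ F, ∀ f' ∈ F,
    Real.sqrt (∑ i ∈ I, (f (p i) - f' (p i)) ^ 2) ≤ ε → f q - f' q ≤ ε

/-- There is a sequence of length `n` such that, for some `ε' > ε`, every element is
`ε'`-independent of its predecessors w.r.t. `F` (the defining property of the
eluder dimension at scale `ε`). -/
def eluderSeq {S : Type*} (F : Set (S → ℝ)) (ε : ℝ) (n : ℕ) : Prop :=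
  ∃ ε' > ε, ∃ p : ℕ → S, ∀ i < n, ¬ epsDep F ε' p (Finset.range i) (p i)

/-- A finite set of indices, each independent of the smaller ones, can be enumerated
increasingly as an eluder sequence. -/
lemma exists_enumeration_of_forall_not_epsDep {S : Type*} (F : Set (S → ℝ)) (ε : ℝ) (p : ℕ → S)
    (I : Finset ℕ) (hI : ∀ t ∈ I, ¬ epsDep F ε p (I.filter (· < t)) (p t)) :
    ∃ q : ℕ → S, (∀ i < I.card, ¬ epsDep F ε q (Finset.range i) (q i)) ∧
      ∀ g : S → ℝ, ∑ i ∈ Finset.range I.card, g (q i) = ∑ t ∈ I, g (p t) := by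
  induction I using Finset.induction_on_max with
  | empty => exact ⟨p, by simp, by simp⟩
  | insert a I ha ih =>
    have haI : a ∉ I := fun h => lt_irrefl _ (ha a h)
    obtain ⟨q, hq, hsum⟩ := ih fun t ht => by
      have h := hI t (Finset.mem_insert_of_mem ht)
      rwa [Finset.filter_insert, if_neg (ha t ht).not_gt] at h
    have hlast := hI a (Finset.mem_insert_self a I)
    rw [Finset.filter_insert, if_neg (lt_irrefl a), Finset.filter_true_of_mem ha] at hlast
    have hupd : ∀ n ≤ I.card, ∀ g : S → ℝ,
        ∑ i ∈ Finset.range n, g (Function.update q I.card (p a) i)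
          = ∑ i ∈ Finset.range n, g (q i) := fun n hn g =>
      Finset.sum_congr rfl fun i hi => by
        rw [Function.update_of_ne ((Finset.mem_range.1 hi).trans_le hn).ne]
    refine ⟨Function.update q I.card (p a), fun i hi => ?_, fun g => ?_⟩
    · rw [Finset.card_insert_of_notMem haI, Nat.lt_succ_iff] at hi
      intro hdep
      rcases hi.lt_or_eq with hlt | rfl
      · refine hq i hlt fun f hf f' hf' hs => ?_
        have h := hdep f hf f' hf'
        rw [hupd i hi fun s => (f s - f' s) ^ 2, Function.update_of_ne hlt.ne] at h
        exact h hs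
      · refine hlast fun f hf f' hf' hs => ?_
        have h := hdep f hf f' hf'
        rw [hupd _ le_rfl fun s => (f s - f' s) ^ 2, hsum fun s => (f s - f' s) ^ 2,
          Function.update_self] at h
        exact h hs
    · rw [Finset.card_insert_of_notMem haI, Finset.sum_range_succ, hupd _ le_rfl,
        hsum, Function.update_self, Finset.sum_insert haI, add_comm]

/-- If, for every `K`-colouring, each index of `B` is independent of some colour class among its
predecessors, then greedy colouring makes each index independent of its own class. -/
lemma exists_coloring_forall_not_epsDep {S : Type*} (F : Set (S → ℝ)) (ε : ℝ) (p : ℕ → S)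
    (K : ℕ) (B : Finset ℕ)
    (hB : ∀ t ∈ B, ∀ c : ℕ → Fin K,
      ∃ j, ¬ epsDep F ε p ((B.filter (· < t)).filter (c · = j)) (p t)) (hK : 0 < K) :
    ∃ c : ℕ → Fin K,
      ∀ t ∈ B, ¬ epsDep F ε p ((B.filter (· < t)).filter (c · = c t)) (p t) := by
  suffices h : ∀ n : ℕ, ∃ c : ℕ → Fin K, ∀ t ∈ B, t < n →
      ¬ epsDep F ε p ((B.filter (· < t)).filter (c · = c t)) (p t) by
    obtain ⟨c, hc⟩ := h (B.sup id + 1)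
    exact ⟨c, fun t ht => hc t ht (Nat.lt_succ_of_le (Finset.le_sup (f := id) ht))⟩
  intro n
  induction n with
  | zero => exact ⟨fun _ => ⟨0, hK⟩, by simp⟩
  | succ n ih =>
    obtain ⟨c, hc⟩ := ih
    by_cases hn : n ∈ B
    swap
    · refine ⟨c, fun t ht htn => hc t ht ?_⟩
      exact (Nat.lt_succ_iff.1 htn).lt_of_ne fun h => hn (h ▸ ht)
    obtain ⟨j, hj⟩ := hB n hn c
    have hfilter : ∀ t ≤ n, ∀ k,
        (B.filter (· < t)).filter (Function.update c n j · = k)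
          = (B.filter (· < t)).filter (c · = k) := fun t ht k =>
      Finset.filter_congr fun s hs => by
        rw [Function.update_of_ne ((Finset.mem_filter.1 hs).2.trans_le ht).ne]
    refine ⟨Function.update c n j, fun t ht htn => ?_⟩
    rw [hfilter t (Nat.lt_succ_iff.1 htn)]
    rcases (Nat.lt_succ_iff.1 htn).lt_or_eq with hlt | rfl
    · rw [Function.update_of_ne hlt.ne]
      exact hc t ht hlt
    · rwa [Function.update_self]

/-- If every `t ∈ B` has a pair of functions in the class that are `ε`-separated at `p t` but
whose squared distance on the preceding points is at most `K ε²`, then `B` has at most `K d`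
elements, where `d` bounds the length of eluder sequences. -/
lemma card_le_mul_of_separated {S : Type*} (F : Set (S → ℝ)) {α ε : ℝ} (hε : α < ε) (hε0 : 0 ≤ ε)
    {d : ℕ} (hd : ∀ n, eluderSeq F α n → n ≤ d) (p : ℕ → S) {K : ℕ} (hK : 0 < K) (B : Finset ℕ)
    (hB : ∀ t ∈ B, ∃ f ∈ F, ∃ f' ∈ F, ε < f (p t) - f' (p t) ∧
      ∑ s ∈ Finset.range t, (f (p s) - f' (p s)) ^ 2 ≤ K * ε ^ 2) :
    B.card ≤ K * d := by
  have : NeZero K := ⟨hK.ne'⟩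
  obtain ⟨c, hc⟩ := exists_coloring_forall_not_epsDep F ε p K B (fun t ht c => by
    by_contra! hdep
    obtain ⟨f, hf, f', hf', hsep, hsum⟩ := hB t ht
    have hclass : ∀ j ∈ (Finset.univ : Finset (Fin K)),
        ε ^ 2 < ∑ s ∈ (B.filter (· < t)).filter (c · = j), (f (p s) - f' (p s)) ^ 2 :=
      fun j _ => by
        by_contra! h
        exact (hdep j f hf f' hf' (Real.sqrt_le_iff.2 ⟨hε0, h⟩)).not_gt hsep
    have hlt := Finset.sum_lt_sum_of_nonempty Finset.univ_nonempty hclass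
    rw [Finset.sum_fiberwise, Finset.sum_const, Finset.card_univ, Fintype.card_fin,
      nsmul_eq_mul] at hlt
    refine (hlt.trans_le (le_trans ?_ hsum)).false
    refine Finset.sum_le_sum_of_subset_of_nonneg (fun s hs => ?_) fun _ _ _ => sq_nonneg _
    exact Finset.mem_range.2 (Finset.mem_filter.1 hs).2) hK
  have hcard : ∀ j ∈ (Finset.univ : Finset (Fin K)), (B.filter (c · = j)).card ≤ d := fun j _ => by
    obtain ⟨q, hq, -⟩ := exists_enumeration_of_forall_not_epsDep F ε p (B.filter (c · = j))
      fun t ht => by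
        obtain ⟨htB, rfl⟩ := Finset.mem_filter.1 ht
        rw [Finset.filter_comm]
        exact hc t htB
    exact hd _ ⟨ε, hε, q, hq⟩
  rw [Finset.card_eq_sum_card_fiberwise (f := c) (t := Finset.univ) fun _ _ => by simp]
  simpa using Finset.sum_le_card_nsmul _ _ _ hcard

/-- Dyadic layer-cake bound. -/
lemma min_le_add_sum_dyadic (α y : ℝ) (n : ℕ) :
    min y (α * 2 ^ n) ≤
      α + ∑ k ∈ Finset.range n, if α * 2 ^ k < y then α * 2 ^ k else 0 := by
  induction n with
  | zero => simp
  | succ n ih =>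
    rw [Finset.sum_range_succ]
    have h2 : α * 2 ^ (n + 1) = α * 2 ^ n + α * 2 ^ n := by ring
    split_ifs with h
    · rw [min_eq_right h.le] at ih
      linarith [min_le_right y (α * 2 ^ (n + 1))]
    · rw [min_eq_left (not_lt.1 h)] at ih
      linarith [min_le_left y (α * 2 ^ (n + 1))]

/-- If the number of indices with `y t > ε` is at most `C / ε²` at all scales `ε ≥ α`, then the
sum of the `y t` exceeds `α T` by at most `2 C / α`. -/
lemma sum_le_of_card_mul_sq_le {T : ℕ} {y : ℕ → ℝ} {α C : ℝ} (hα : 0 < α)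
    (hy : ∀ t < T, y t ≤ 1)
    (hC : ∀ ε ≥ α, (((Finset.range T).filter (ε < y ·)).card : ℝ) * ε ^ 2 ≤ C) :
    ∑ t ∈ Finset.range T, y t ≤ α * T + 2 * C / α := by
  have hC0 : 0 ≤ C := le_trans (by positivity) (hC α le_rfl)
  obtain ⟨n, hn⟩ := pow_unbounded_of_one_lt (1 / α) (one_lt_two : (1 : ℝ) < 2)
  rw [div_lt_iff₀ hα, mul_comm] at hn
  have hgeom : ∑ k ∈ Finset.range n, ((1 : ℝ) / 2) ^ k ≤ 2 :=
    sum_geometric_two_le n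
  calc ∑ t ∈ Finset.range T, y t
      ≤ ∑ t ∈ Finset.range T,
          (α + ∑ k ∈ Finset.range n, if α * 2 ^ k < y t then α * 2 ^ k else 0) :=
        Finset.sum_le_sum fun t ht => by
          have h := min_le_add_sum_dyadic α (y t) n
          rwa [min_eq_left ((hy t (Finset.mem_range.1 ht)).trans hn.le)] at h
    _ = α * T + ∑ k ∈ Finset.range n,
          (((Finset.range T).filter (α * 2 ^ k < y ·)).card : ℝ) * (α * 2 ^ k) := by
        rw [Finset.sum_add_distrib, Finset.sum_comm]
        simp [← Finset.sum_filter, mul_comm]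
    _ ≤ α * T + ∑ k ∈ Finset.range n, C / α * (1 / 2) ^ k := by
        refine add_le_add_right (Finset.sum_le_sum fun k _ => ?_) _
        have hk : 0 < α * 2 ^ k := by positivity
        have h := hC (α * 2 ^ k) (le_mul_of_one_le_right hα.le (one_le_pow₀ one_le_two))
        have heq : C / α * (1 / 2) ^ k = C / (α * 2 ^ k) := by
          rw [one_div, inv_pow]; field_simp
        rw [heq, le_div_iff₀ hk, mul_assoc, ← sq]
        exact h
    _ ≤ α * T + 2 * C / α := by
        rw [← Finset.mul_sum]
        have h := mul_le_mul_of_nonneg_left hgeom (div_nonneg hC0 hα.le)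
        rw [mul_comm 2 C, mul_div_right_comm]
        linarith

/-- Two functions that fit the same data with squared error at most `R` are at squared distance
at most `4 R` on that data. -/
lemma sum_sub_sq_le_four_mul {ι : Type*} (s : Finset ι) (u v z : ι → ℝ) {R : ℝ}
    (hu : ∑ i ∈ s, (u i - z i) ^ 2 ≤ R) (hv : ∑ i ∈ s, (v i - z i) ^ 2 ≤ R) :
    ∑ i ∈ s, (u i - v i) ^ 2 ≤ 4 * R := by
  calc ∑ i ∈ s, (u i - v i) ^ 2
      ≤ ∑ i ∈ s, (2 * (u i - z i) ^ 2 + 2 * (v i - z i) ^ 2) :=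
        Finset.sum_le_sum fun i _ => by nlinarith [sq_nonneg (u i + v i - 2 * z i)]
    _ ≤ 4 * R := by
        rw [Finset.sum_add_distrib, ← Finset.mul_sum, ← Finset.mul_sum]
        linarith

/-- the deterministic core of the long-term-constraints guarantee. With version
spaces `F_t = {f ∈ F_0 : ∑_{s<t} (f(a_s,x_s) - ẑ_s)² ≤ R}`, `R ≥ 1`, if `f* ∈ F_t` for
every `t < T` and each played action lies in the optimistic set
(`inf_{f ∈ F_t} f(a_t, x_t) ≤ 0`), then for every `α > 0`,
`∑_{t<T} f*(a_t, x_t) ≤ α T + (20 R / α) · E(F_0, α)`, where `d = E(F_0, α)` is the eluder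
dimension (the greatest length of an eluder sequence at scale `α`). -/
theorem long_term_constraint_violation_bound
    {A X : Type*} (F0 : Set (A × X → ℝ))
    (hbdd : ∀ f ∈ F0, ∀ p : A × X, f p ∈ Set.Icc (-1 : ℝ) 1)
    (fstar : A × X → ℝ) (hfstar0 : fstar ∈ F0)
    (T : ℕ) (p : ℕ → A × X) (zhat : ℕ → ℝ) (R : ℝ) (hR : 1 ≤ R)
    (Fc : ℕ → Set (A × X → ℝ))
    (hFc : ∀ t, Fc t = {f ∈ F0 | ∑ s ∈ Finset.range t, (f (p s) - zhat s) ^ 2 ≤ R})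
    (hfstar : ∀ t < T, fstar ∈ Fc t)
    (hopt : ∀ t < T, sInf ((fun f : A × X → ℝ => f (p t)) '' Fc t) ≤ 0)
    (α : ℝ) (hα : 0 < α) (d : ℕ)
    (hd : IsGreatest {n : ℕ | eluderSeq F0 α n} d) :
    ∑ t ∈ Finset.range T, fstar (p t) ≤ α * T + (20 * R / α) * d := by
  have hy : ∀ t < T, fstar (p t) ≤ 1 := fun t _ => (hbdd fstar hfstar0 (p t)).2
  have hcount : ∀ ε ≥ α,
      (((Finset.range T).filter fun t => ε < fstar (p t)).card : ℝ) * ε ^ 2 ≤ 5 * R * d := by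
    intro ε hε
    have hε0 : 0 < ε := hα.trans_le hε
    set B := (Finset.range T).filter fun t => ε < fstar (p t) with hBdef
    rcases B.eq_empty_or_nonempty with hB | hB
    · rw [hB, Finset.card_empty, Nat.cast_zero, zero_mul]
      positivity
    obtain ⟨t₀, ht₀, hmin⟩ := B.exists_min_image (fun t => fstar (p t)) hB
    obtain ⟨ht₀T, hεt₀⟩ := Finset.mem_filter.1 ht₀
    have hε1 : ε ≤ 1 := hεt₀.le.trans (hy t₀ (Finset.mem_range.1 ht₀T))
    obtain ⟨ε', hεε', hε't₀⟩ := exists_between hεt₀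
    have hKpos : 0 < ⌈4 * R / ε ^ 2⌉₊ := Nat.ceil_pos.2 (by positivity)
    have hcard := card_le_mul_of_separated F0 (hε.trans_lt hεε') (hε0.trans hεε').le
      (fun n hn => hd.2 hn) p hKpos B fun t ht => by
        have htT := Finset.mem_range.1 (Finset.mem_filter.1 ht).1
        have hsInf : sInf ((fun f : A × X → ℝ => f (p t)) '' Fc t) < fstar (p t) - ε' :=
          (hopt t htT).trans_lt (sub_pos.2 (hε't₀.trans_le (hmin t ht)))
        obtain ⟨_, ⟨f', hf', rfl⟩, hlt⟩ :=
          exists_lt_of_csInf_lt (Set.Nonempty.image _ ⟨fstar, hfstar t htT⟩) hsInf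
        have hfs := hfstar t htT
        rw [hFc] at hf' hfs
        refine ⟨fstar, hfstar0, f', hf'.1, by linarith, ?_⟩
        refine (sum_sub_sq_le_four_mul _ (fun s => fstar (p s)) (fun s => f' (p s)) zhat
          hfs.2 hf'.2).trans ?_
        calc 4 * R = 4 * R / ε ^ 2 * ε ^ 2 := by field_simp
          _ ≤ ⌈4 * R / ε ^ 2⌉₊ * ε' ^ 2 := by
            gcongr
            exact Nat.le_ceil _
    have hceil : (⌈4 * R / ε ^ 2⌉₊ : ℝ) * ε ^ 2 ≤ 5 * R := by
      have h := mul_le_mul_of_nonneg_right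
        (Nat.ceil_lt_add_one (a := 4 * R / ε ^ 2) (by positivity)).le (sq_nonneg ε)
      rw [add_mul, div_mul_cancel₀ _ (by positivity), one_mul] at h
      nlinarith
    calc (B.card : ℝ) * ε ^ 2 ≤ (⌈4 * R / ε ^ 2⌉₊ * d : ℝ) * ε ^ 2 := by
          gcongr
          exact_mod_cast hcard
      _ = ⌈4 * R / ε ^ 2⌉₊ * ε ^ 2 * d := by ring
      _ ≤ 5 * R * d := by gcongr
  calc ∑ t ∈ Finset.range T, fstar (p t) ≤ α * T + 2 * (5 * R * d) / α :=
        sum_le_of_card_mul_sq_le hα hy hcount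
    _ = α * T + 10 * R / α * d := by ring
    _ ≤ α * T + 20 * R / α * d := by
        gcongr
        norm_num
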